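/- arXiv:2311.10185 — 5 statements merged into one kernel-verified Lean document; each statement's English description precedes it below -/
import Mathlib

section
/- Let h : ℂ → ℝ be continuous on the closed unit disk and harmonic in 𝔻, with ∫_𝔻 ‖∇h‖² dA < ∞ and ∫_0^{2π} h(e^{iθ}) dθ = 0. Then ∫_0^{2π} h(e^{iθ})² dθ ≤ ∫_𝔻 ‖∇h‖² dA. -/
open MeasureTheory Real

/-- The Laplacian of a real-valued function on `ℂ ≅ ℝ²`, as the sum of the second
derivatives in the directions `1` and `I`. -/
noncomputable def cLaplacian (h : ℂ → ℝ) (z : ℂ) : ℝ :=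
  fderiv ℝ (fun w => fderiv ℝ h w 1) z 1
    + fderiv ℝ (fun w => fderiv ℝ h w Complex.I) z Complex.I

open Metric ComplexConjugate Nat in
theorem circleAverage_pow_mul_conj {f : ℂ → ℂ} {r : ℝ} (hr : 0 < r)
    (hf : DiffContOnCl ℂ f (ball 0 r)) (n : ℕ) :
    circleAverage (fun z ↦ z ^ n * conj (f z)) 0 r
      = r ^ (2 * n) * conj ((n ! : ℂ)⁻¹ * iteratedDeriv n f 0) := by
  have hci : CircleIntegrable (fun z ↦ (r : ℂ) ^ (2 * n) * (1 / z ^ n * f z)) 0 r := by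
    refine ContinuousOn.circleIntegrable hr.le ?_
    refine continuousOn_const.mul (ContinuousOn.mul ?_
      (hf.continuousOn_ball.mono sphere_subset_closedBall))
    refine continuousOn_const.div (by fun_prop) fun z hz ↦ pow_ne_zero _ ?_
    exact ne_of_mem_sphere hz hr.ne'
  have key : circleAverage (fun z ↦ (r : ℂ) ^ (2 * n) * (1 / z ^ n * f z)) 0 r
      = r ^ (2 * n) * ((n ! : ℂ)⁻¹ * iteratedDeriv n f 0) := by
    have h1 := hf.circleIntegral_one_div_sub_center_pow_smul hr n
    rw [circleAverage_eq_circleIntegral hr.ne']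
    have h2 : (∮ z in C(0, r), (z - 0)⁻¹ • ((r : ℂ) ^ (2 * n) * (1 / z ^ n * f z)))
        = r ^ (2 * n) * ∮ z in C(0, r), (1 / (z - 0) ^ (n + 1)) • f z := by
      rw [← circleIntegral.integral_const_mul]
      congr 1
      ext z
      simp only [sub_zero, smul_eq_mul, one_div, pow_succ, mul_inv]
      ring
    rw [h2, h1]
    simp only [smul_eq_mul]
    have : (2 * π * Complex.I : ℂ) ≠ 0 := Complex.two_pi_I_ne_zero
    field_simp
  have hc := (Complex.conjCLE : ℂ →L[ℝ] ℂ).circleAverage_comp_comm hci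
  rw [key] at hc
  simp only [ContinuousLinearEquiv.coe_coe, Complex.conjCLE_apply, map_mul, map_pow,
    Complex.conj_ofReal] at hc
  rw [map_mul, ← hc]
  refine circleAverage_congr_sphere fun z hz ↦ ?_
  have hz' : z * conj z = r ^ 2 := by
    rw [Complex.mul_conj, Complex.normSq_eq_norm_sq]
    simp_all [abs_of_pos hr]
  have hz0 : conj z ≠ 0 := by
    simpa using ne_of_mem_sphere hz (by positivity)
  simp only [Function.comp_apply, Complex.conjCLE_apply, map_mul, map_pow, map_div₀, map_one,
    pow_mul, ← hz', mul_pow, Complex.conj_conj]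
  field_simp

open Metric ComplexConjugate Nat in
/-- **Parseval's identity** for the Taylor coefficients of a holomorphic function. -/
theorem hasSum_sq_norm_taylorCoeff {f : ℂ → ℂ} {R r : ℝ} (hf : DifferentiableOn ℂ f (ball 0 R))
    (hr : 0 < r) (hrR : r < R) :
    HasSum (fun n : ℕ ↦ ‖(n ! : ℂ)⁻¹ * iteratedDeriv n f 0‖ ^ 2 * r ^ (2 * n))
      (circleAverage (fun z ↦ ‖f z‖ ^ 2) 0 r) := by
  set a : ℕ → ℂ := fun n ↦ (n ! : ℂ)⁻¹ * iteratedDeriv n f 0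
  have hsum : ∀ z ∈ ball (0 : ℂ) R, HasSum (fun n ↦ a n * z ^ n) (f z) := fun z hz ↦ by
    have := Complex.hasSum_taylorSeries_on_ball hf hz
    simpa only [a, smul_eq_mul, sub_zero, mul_comm, mul_left_comm] using this
  have hcl : closedBall (0 : ℂ) r ⊆ ball 0 R := closedBall_subset_ball hrR
  have hfr : DiffContOnCl ℂ f (ball 0 r) := hf.diffContOnCl_ball hcl
  have hcirc : Continuous fun θ ↦ f (circleMap 0 r θ) :=
    hfr.continuousOn_ball.comp_continuous (by fun_prop) fun θ ↦
      circleMap_mem_closedBall _ hr.le _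
  obtain ⟨C, hC⟩ := (isCompact_closedBall (0 : ℂ) r).exists_bound_of_continuousOn
    hfr.continuousOn_ball
  have hs : Summable fun n ↦ ‖a n‖ * r ^ n := by
    have := (hsum r (by simpa [abs_of_pos hr] using hrR)).summable.norm
    simpa [abs_of_pos hr] using this
  have key : HasSum (fun n ↦ ∫ θ in (0 : ℝ)..2 * π,
      a n * (circleMap 0 r θ ^ n * conj (f (circleMap 0 r θ))))
      (∫ θ in (0 : ℝ)..2 * π, f (circleMap 0 r θ) * conj (f (circleMap 0 r θ))) := by
    refine intervalIntegral.hasSum_integral_of_dominated_convergence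
      (fun n _ ↦ ‖a n‖ * r ^ n * C) (fun n ↦ ?_) (fun n ↦ ?_) ?_ ?_ ?_
    · have : Continuous fun θ ↦ a n * (circleMap 0 r θ ^ n * conj (f (circleMap 0 r θ))) := by
        exact continuous_const.mul
          (((continuous_circleMap 0 r).pow n).mul (Complex.continuous_conj.comp hcirc))
      exact this.aestronglyMeasurable
    · refine .of_forall fun θ _ ↦ ?_
      have := hC _ (circleMap_mem_closedBall 0 hr.le θ)
      simp only [norm_mul, norm_pow, norm_circleMap_zero, RCLike.norm_conj, abs_of_pos hr]
      rw [← mul_assoc]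
      gcongr
    · exact .of_forall fun θ _ ↦ hs.mul_right C
    · exact intervalIntegrable_const
    · refine .of_forall fun θ _ ↦ ?_
      simp only [← mul_assoc]
      exact (hsum _ (hcl (circleMap_mem_closedBall 0 hr.le θ))).mul_right _
  have key2 := (key.const_smul (2 * π)⁻¹)
  rw [← Complex.hasSum_ofReal]
  convert key2 using 1
  · ext n
    have := circleAverage_pow_mul_conj hr hfr n
    rw [circleAverage_def] at this
    rw [intervalIntegral.integral_const_mul, ← mul_smul_comm, this, mul_left_comm,
      Complex.mul_conj, Complex.normSq_eq_norm_sq]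
    push_cast
    rw [mul_comm]
  · rw [circleAverage_def, Complex.real_smul, smul_eq_mul, Complex.ofReal_mul,
      ← intervalIntegral.integral_ofReal]
    congr 2
    ext θ
    rw [Complex.mul_conj, Complex.normSq_eq_norm_sq]

open Metric in
theorem lintegral_ball_zero_eq_circleAverage {f : ℂ → ℝ} {R : ℝ} (hf : ContinuousOn f (ball 0 R))
    (h0 : ∀ z, 0 ≤ f z) :
    ∫⁻ z in ball (0 : ℂ) R, ENNReal.ofReal (f z)
      = ∫⁻ r in Set.Ioo 0 R, ENNReal.ofReal (2 * π * r * circleAverage f 0 r) := by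
  have hpolar (p : ℝ × ℝ) : Complex.polarCoord.symm p = circleMap 0 p.1 p.2 := by
    simp [circleMap, Complex.exp_mul_I]
  have hmem : ∀ p ∈ Set.Ioo 0 R ×ˢ Set.Ioo (-π) π, circleMap 0 p.1 p.2 ∈ ball (0 : ℂ) R :=
    fun p hp ↦ by simpa [abs_of_pos hp.1.1] using hp.1.2
  have hmeas : MeasurableSet (Set.Ioo 0 R ×ˢ Set.Ioo (-π) π) :=
    measurableSet_Ioo.prod measurableSet_Ioo
  have hcont : ContinuousOn (fun p : ℝ × ℝ ↦ p.1 * f (circleMap 0 p.1 p.2))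
      (Set.Ioo 0 R ×ˢ Set.Ioo (-π) π) := by
    refine continuousOn_fst.mul (hf.comp (Continuous.continuousOn ?_) hmem)
    simp only [circleMap]
    fun_prop
  calc ∫⁻ z in ball (0 : ℂ) R, ENNReal.ofReal (f z)
      = ∫⁻ p in polarCoord.target, ENNReal.ofReal p.1 •
          (ball (0 : ℂ) R).indicator (fun z ↦ ENNReal.ofReal (f z))
            (Complex.polarCoord.symm p) := by
        rw [Complex.lintegral_comp_polarCoord_symm, lintegral_indicator measurableSet_ball]
    _ = ∫⁻ p in polarCoord.target, (Set.Ioo 0 R ×ˢ Set.Ioo (-π) π).indicator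
          (fun p ↦ ENNReal.ofReal (p.1 * f (circleMap 0 p.1 p.2))) p := by
        refine setLIntegral_congr_fun polarCoord.open_target.measurableSet fun p hp ↦ ?_
        have hp1 : 0 < p.1 := hp.1
        have hiff : circleMap 0 p.1 p.2 ∈ ball (0 : ℂ) R ↔
            p ∈ Set.Ioo 0 R ×ˢ Set.Ioo (-π) π := by
          refine ⟨fun h ↦ ⟨⟨hp1, ?_⟩, hp.2⟩, hmem p⟩
          simpa [abs_of_pos hp1] using h
        simp only [hpolar]
        by_cases h : p ∈ Set.Ioo 0 R ×ˢ Set.Ioo (-π) π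
        · rw [Set.indicator_of_mem h, Set.indicator_of_mem (hiff.2 h), smul_eq_mul,
            ENNReal.ofReal_mul hp1.le]
        · rw [Set.indicator_of_notMem h, Set.indicator_of_notMem (mt hiff.1 h), smul_zero]
    _ = ∫⁻ p in Set.Ioo 0 R ×ˢ Set.Ioo (-π) π,
          ENNReal.ofReal (p.1 * f (circleMap 0 p.1 p.2)) := by
        rw [setLIntegral_indicator hmeas, Set.inter_eq_left.2]
        exact Set.prod_mono_left Set.Ioo_subset_Ioi_self
    _ = ∫⁻ r in Set.Ioo 0 R, ∫⁻ θ in Set.Ioo (-π) π,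
          ENNReal.ofReal (r * f (circleMap 0 r θ)) := by
        rw [Measure.volume_eq_prod, setLIntegral_prod]
        exact (hcont.aemeasurable hmeas).ennreal_ofReal
    _ = ∫⁻ r in Set.Ioo 0 R, ENNReal.ofReal (2 * π * r * circleAverage f 0 r) := by
        refine setLIntegral_congr_fun measurableSet_Ioo fun r hr ↦ ?_
        have hc : Continuous fun θ ↦ r * f (circleMap 0 r θ) :=
          continuous_const.mul (hf.comp_continuous (by fun_prop) fun θ ↦ by
            simpa [abs_of_pos hr.1] using hr.2)
        rw [restrict_Ioo_eq_restrict_Ioc, ← ofReal_integral_eq_lintegral_ofReal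
          (hc.integrableOn_Ioc) (.of_forall fun θ ↦ mul_nonneg hr.1.le (h0 _)),
          ← intervalIntegral.integral_of_le (by linarith [pi_pos]),
          intervalIntegral.integral_const_mul, circleAverage_eq_integral_add (-π),
          intervalIntegral.integral_comp_add_right (fun θ ↦ f (circleMap 0 r θ))]
        congr 1
        rw [smul_eq_mul, zero_add, show 2 * π + -π = π by ring]
        field_simp

open Metric Nat Finset in
/-- **Bessel's inequality** for the area integral of a holomorphic function. -/
theorem ofReal_sum_taylorCoeff_le_lintegral {g : ℂ → ℂ} (hg : DifferentiableOn ℂ g (ball 0 1))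
    (s : Finset ℕ) :
    ENNReal.ofReal (∑ n ∈ s, π / (n + 1) * ‖(n ! : ℂ)⁻¹ * iteratedDeriv n g 0‖ ^ 2)
      ≤ ∫⁻ z in ball (0 : ℂ) 1, ENNReal.ofReal (‖g z‖ ^ 2) := by
  set b : ℕ → ℂ := fun n ↦ (n ! : ℂ)⁻¹ * iteratedDeriv n g 0
  have hint : ∫ r in (0 : ℝ)..1, ∑ n ∈ s, 2 * π * ‖b n‖ ^ 2 * r ^ (2 * n + 1)
      = ∑ n ∈ s, π / (n + 1) * ‖b n‖ ^ 2 := by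
    rw [intervalIntegral.integral_finsetSum fun n _ ↦
      (Continuous.intervalIntegrable (by fun_prop) _ _)]
    refine sum_congr rfl fun n _ ↦ ?_
    rw [intervalIntegral.integral_const_mul, integral_pow]
    push_cast
    simp only [one_pow, zero_pow (succ_ne_zero _), sub_zero]
    field_simp
    ring
  change ENNReal.ofReal (∑ n ∈ s, π / (n + 1) * ‖b n‖ ^ 2) ≤ _
  rw [lintegral_ball_zero_eq_circleAverage (f := fun z ↦ ‖g z‖ ^ 2) (hg.continuousOn.norm.pow 2)
    fun z ↦ sq_nonneg _, ← hint, intervalIntegral.integral_of_le zero_le_one, ← restrict_Ioo_eq_restrict_Ioc,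
    ofReal_integral_eq_lintegral_ofReal]
  · refine setLIntegral_mono' measurableSet_Ioo fun r hr ↦ ENNReal.ofReal_le_ofReal ?_
    have hr0 := hr.1
    have := sum_le_hasSum s (fun n _ ↦ mul_nonneg (sq_nonneg _) (pow_nonneg hr0.le _))
      (hasSum_sq_norm_taylorCoeff hg hr0 hr.2)
    calc ∑ n ∈ s, 2 * π * ‖b n‖ ^ 2 * r ^ (2 * n + 1)
        = 2 * π * r * ∑ n ∈ s, ‖b n‖ ^ 2 * r ^ (2 * n) := by
          rw [mul_sum]
          exact sum_congr rfl fun n _ ↦ by ring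
      _ ≤ _ := by gcongr
  · exact ((by fun_prop : Continuous fun r : ℝ ↦
      ∑ n ∈ s, 2 * π * ‖b n‖ ^ 2 * r ^ (2 * n + 1)).integrableOn_Ioc).mono_set
      Set.Ioo_subset_Ioc_self
  · refine (ae_restrict_iff' measurableSet_Ioo).2 (.of_forall fun r hr ↦ ?_)
    have hr0 := hr.1
    exact sum_nonneg fun n _ ↦ by positivity

open Metric Nat Finset in
theorem circleAverage_sq_norm_le_lintegral_deriv {f : ℂ → ℂ}
    (hf : DifferentiableOn ℂ f (ball 0 1)) (hf0 : f 0 = 0) {r : ℝ} (hr : r ∈ Set.Ioo 0 1) :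
    ENNReal.ofReal (π * circleAverage (fun z ↦ ‖f z‖ ^ 2) 0 r)
      ≤ ∫⁻ z in ball (0 : ℂ) 1, ENNReal.ofReal (‖deriv f z‖ ^ 2) := by
  by_cases htop : ∫⁻ z in ball (0 : ℂ) 1, ENNReal.ofReal (‖deriv f z‖ ^ 2) = ⊤
  · exact htop ▸ le_top
  have hr0 := hr.1
  refine ENNReal.ofReal_le_of_le_toReal (le_of_tendsto'
    ((hasSum_sq_norm_taylorCoeff hf hr.1 hr.2).mul_left π |>.tendsto_sum_nat) fun N ↦ ?_)
  refine le_trans ?_ (ENNReal.toReal_mono htop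
    (ofReal_sum_taylorCoeff_le_lintegral (hf.deriv isOpen_ball) (range N)))
  rw [ENNReal.toReal_ofReal (sum_nonneg fun n _ ↦ by positivity)]
  refine (sum_le_sum_of_subset_of_nonneg (range_mono N.le_succ)
    fun n _ _ ↦ by positivity).trans ?_
  rw [sum_range_succ']
  simp only [iteratedDeriv_zero, hf0, mul_zero, norm_zero, ne_eq, OfNat.ofNat_ne_zero,
    not_false_eq_true, zero_pow, zero_mul, add_zero]
  refine sum_le_sum fun n _ ↦ ?_
  rw [iteratedDeriv_succ', factorial_succ]
  have hpow : r ^ (2 * (n + 1)) ≤ 1 := pow_le_one₀ hr.1.le hr.2.le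
  set d := iteratedDeriv n (deriv f) 0
  have hn : ‖((((n + 1) * n ! : ℕ) : ℂ))⁻¹ * d‖ = ‖(n ! : ℂ)⁻¹ * d‖ / (n + 1) := by
    have : ‖(n : ℂ) + 1‖ = n + 1 := by exact_mod_cast Complex.norm_natCast (n + 1)
    push_cast
    rw [mul_inv, mul_assoc, norm_mul, norm_inv, this]
    field_simp
  rw [hn, div_pow]
  set x := ‖(n ! : ℂ)⁻¹ * d‖
  calc π * (x ^ 2 / (n + 1) ^ 2 * r ^ (2 * (n + 1))) ≤ π * (x ^ 2 / (n + 1) ^ 2 * 1) := by gcongr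
    _ = π / (n + 1) * x ^ 2 * (1 / (n + 1)) := by field_simp
    _ ≤ π / (n + 1) * x ^ 2 * 1 := by
        gcongr
        rw [div_le_one (by positivity)]
        linarith [(n.cast_nonneg : (0 : ℝ) ≤ n)]
    _ = _ := mul_one _

open Metric in
theorem circleAverage_sq_re_of_apply_center_eq_zero {f : ℂ → ℂ} {c : ℂ} {r : ℝ} (hr : 0 < r)
    (hf : DiffContOnCl ℂ f (ball c r)) (hf0 : f c = 0) :
    2 * circleAverage (fun z ↦ (f z).re ^ 2) c r = circleAverage (fun z ↦ ‖f z‖ ^ 2) c r := by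
  have hcs : ContinuousOn f (sphere c r) := hf.continuousOn_ball.mono sphere_subset_closedBall
  have hi : CircleIntegrable (fun z ↦ f z ^ 2) c r := (hcs.pow 2).circleIntegrable hr.le
  have hn : CircleIntegrable (fun z ↦ ‖f z‖ ^ 2) c r := (hcs.norm.pow 2).circleIntegrable hr.le
  have hre : CircleIntegrable (fun z ↦ (f z ^ 2).re) c r :=
    (Complex.continuous_re.comp_continuousOn (hcs.pow 2)).circleIntegrable hr.le
  have hmean : circleAverage (fun z ↦ (f z ^ 2).re) c r = 0 := by
    have h1 : circleAverage (fun z ↦ f z ^ 2) c r = 0 := by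
      have h2 : DiffContOnCl ℂ (fun z ↦ f z ^ 2) (ball c |r|) := by
        rw [abs_of_pos hr]
        simpa only [pow_two, smul_eq_mul] using hf.smul hf
      simpa [hf0] using h2.circleAverage
    have := Complex.reCLM.circleAverage_comp_comm hi
    rw [h1] at this
    simpa [Function.comp_def] using this
  have := circleAverage_fun_add hn hre
  rw [hmean, add_zero] at this
  rw [← this, ← smul_eq_mul, ← circleAverage_fun_smul]
  congr 1
  ext z
  rw [← Complex.normSq_eq_norm_sq, Complex.normSq_apply, smul_eq_mul, pow_two (f z),
    Complex.mul_re]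
  ring

open Metric InnerProductSpace in
theorem harmonicOnNhd_of_cLaplacian_eq_zero {h : ℂ → ℝ} {s : Set ℂ} (hs : IsOpen s)
    (hC2 : ContDiffOn ℝ 2 h s) (hharm : ∀ z ∈ s, cLaplacian h z = 0) : HarmonicOnNhd h s := by
  have hC : ∀ z ∈ s, ContDiffAt ℝ 2 h z := fun z hz ↦ hC2.contDiffAt (hs.mem_nhds hz)
  refine fun z hz ↦ ⟨hC z hz, ?_⟩
  filter_upwards [hs.mem_nhds hz] with w hw
  have hd : DifferentiableAt ℝ (fderiv ℝ h) w :=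
    ((hC w hw).fderiv_right (m := 1) (by norm_num)).differentiableAt one_ne_zero
  have hw0 := hharm w hw
  rw [cLaplacian, fderiv_clm_apply hd (by fun_prop), fderiv_clm_apply hd (by fun_prop)] at hw0
  simpa [laplacian_eq_iteratedFDeriv_complexPlane, iteratedFDeriv_two_apply] using hw0

theorem norm_fderiv_re_comp {f : ℂ → ℂ} {z : ℂ} (hf : DifferentiableAt ℂ f z) :
    ‖fderiv ℝ (fun w ↦ (f w).re) z‖ = ‖deriv f z‖ := by
  have h1 : fderiv ℝ (fun w ↦ (f w).re) z
      = Complex.reCLM.comp ((ContinuousLinearMap.toSpanSingleton ℂ (deriv f z)).restrictScalars ℝ) :=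
    (Complex.reCLM.hasFDerivAt.comp z (hf.hasDerivAt.hasFDerivAt.restrictScalars ℝ)).fderiv
  have happ (v : ℂ) : fderiv ℝ (fun w ↦ (f w).re) z v = (v * deriv f z).re := by
    rw [h1]; simp
  refine le_antisymm (ContinuousLinearMap.opNorm_le_bound _ (norm_nonneg _) fun v ↦ ?_) ?_
  · rw [happ, mul_comm, ← norm_mul]
    exact Complex.abs_re_le_norm _
  · have h2 := (fderiv ℝ (fun w ↦ (f w).re) z).le_opNorm (starRingEnd ℂ (deriv f z))
    rw [happ, mul_comm, Complex.mul_conj, Complex.ofReal_re, Complex.normSq_eq_norm_sq,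
      RCLike.norm_conj, Real.norm_of_nonneg (sq_nonneg _), pow_two] at h2
    rcases (norm_nonneg (deriv f z)).eq_or_lt with h0 | h0
    · rw [← h0]; positivity
    · exact le_of_mul_le_mul_right h2 h0

/-- Steklov-type inequality: if `h` is continuous on the closed unit disk, harmonic in the
open disk, has finite Dirichlet energy, and its boundary trace has zero average, then
`∫_0^{2π} h(e^{iθ})² dθ ≤ ∫_𝔻 ‖∇h‖² dA`. -/
theorem steklov_inequality_harmonic_zero_average
    (h : ℂ → ℝ)
    (hcont : ContinuousOn h (Metric.closedBall (0:ℂ) 1))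
    (hC2 : ContDiffOn ℝ 2 h (Metric.ball (0:ℂ) 1))
    (hharm : ∀ z ∈ Metric.ball (0:ℂ) 1, cLaplacian h z = 0)
    (hfin : (∫⁻ z in Metric.ball (0:ℂ) 1, ENNReal.ofReal (‖fderiv ℝ h z‖ ^ 2)) < ⊤)
    (havg : (∫ θ in (0:ℝ)..(2 * π), h (Complex.exp (θ * Complex.I))) = 0) :
    (∫ θ in (0:ℝ)..(2 * π), (h (Complex.exp (θ * Complex.I))) ^ 2)
      ≤ ∫ z in Metric.ball (0:ℂ) 1, ‖fderiv ℝ h z‖ ^ 2 := by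
  have hH := harmonicOnNhd_of_cLaplacian_eq_zero Metric.isOpen_ball hC2 hharm
  have hexp (θ : ℝ) : Complex.exp (θ * Complex.I) = circleMap 0 1 θ := by simp [circleMap]
  simp only [hexp] at havg ⊢
  have h0 : h 0 = 0 := by
    have hHc : InnerProductSpace.HarmonicContOnCl h (Metric.ball 0 |1|) :=
      ⟨by simpa using hH, by simpa [closure_ball] using hcont⟩
    rw [← hHc.circleAverage_eq, circleAverage_def, havg, smul_zero]
  obtain ⟨F₀, hF₀, hre₀⟩ := hH.exists_analyticOnNhd_ball_re_eq
  set F : ℂ → ℂ := fun z ↦ F₀ z - F₀ 0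
  have hF : DifferentiableOn ℂ F (Metric.ball 0 1) := hF₀.differentiableOn.sub_const _
  have hF0 : F 0 = 0 := sub_self _
  have hre : Set.EqOn (fun z ↦ (F z).re) h (Metric.ball 0 1) := fun z hz ↦ by
    have h1 := hre₀ hz
    have h2 := hre₀ (Metric.mem_ball_self one_pos)
    simp_all [F]
  have hgrad : ∀ z ∈ Metric.ball (0 : ℂ) 1, ‖fderiv ℝ h z‖ = ‖deriv F z‖ := fun z hz ↦ by
    have hnhds := Metric.isOpen_ball.mem_nhds hz
    rw [← norm_fderiv_re_comp (hF.differentiableAt hnhds),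
      (hre.eventuallyEq_of_mem hnhds).fderiv_eq]
  have hlint : ∫⁻ z in Metric.ball (0 : ℂ) 1, ENNReal.ofReal (‖deriv F z‖ ^ 2)
      = ∫⁻ z in Metric.ball (0 : ℂ) 1, ENNReal.ofReal (‖fderiv ℝ h z‖ ^ 2) :=
    setLIntegral_congr_fun measurableSet_ball fun z hz ↦ by rw [hgrad z hz]
  have hmeas : AEStronglyMeasurable (fun z ↦ ‖fderiv ℝ h z‖ ^ 2)
      (volume.restrict (Metric.ball (0 : ℂ) 1)) :=
    (((hC2.continuousOn_fderiv_of_isOpen Metric.isOpen_ball one_le_two).norm.pow 2)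
      |>.aestronglyMeasurable measurableSet_ball)
  rw [integral_eq_lintegral_of_nonneg_ae (.of_forall fun z ↦ sq_nonneg _) hmeas]
  set D := ∫⁻ z in Metric.ball (0 : ℂ) 1, ENNReal.ofReal (‖fderiv ℝ h z‖ ^ 2)
  have hinner : ∀ r ∈ Set.Ioo (0 : ℝ) 1,
      circleAverage (fun z ↦ h z ^ 2) 0 r ≤ D.toReal / (2 * π) := fun r hr ↦ by
    have hsub : Metric.closedBall (0 : ℂ) r ⊆ Metric.ball 0 1 :=
      Metric.closedBall_subset_ball hr.2
    have h1 := circleAverage_sq_norm_le_lintegral_deriv hF hF0 hr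
    rw [hlint, ENNReal.ofReal_le_iff_le_toReal hfin.ne,
      ← circleAverage_sq_re_of_apply_center_eq_zero hr.1 (hF.diffContOnCl_ball hsub) hF0] at h1
    rw [le_div_iff₀ two_pi_pos, circleAverage_congr_sphere (f₂ := fun z ↦ (F z).re ^ 2)]
    · linarith
    · intro z hz
      have hz' : z ∈ Metric.ball (0 : ℂ) 1 := by
        rw [abs_of_pos hr.1] at hz
        exact hsub (Metric.sphere_subset_closedBall hz)
      simp only [← hre hz']
  have hcts : ContinuousOn (circleAverage (fun z ↦ h z ^ 2) 0) (Set.Icc 0 1) :=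
    ContinuousOn.circleAverage ((hcont.pow 2).mono fun z hz ↦ by simpa using hz.2) fun r hr ↦ hr.1
  have hone : circleAverage (fun z ↦ h z ^ 2) 0 1 ≤ D.toReal / (2 * π) := by
    refine le_on_closure hinner ?_ continuousOn_const (x := 1) ?_ <;>
      rw [closure_Ioo zero_ne_one]
    exacts [hcts, Set.right_mem_Icc.2 zero_le_one]
  rw [le_div_iff₀ two_pi_pos, circleAverage_def, smul_eq_mul] at hone
  field_simp at hone
  exact hone
end

section
/- Let ψ : ℂ → ℝ be continuously differentiable on an open set containing the closed unit disk, and suppose ∫_0^{2π} ψ(e^{iθ}) dθ = 0. Then Q₀(ψ) ≥ 0, i.e. ∫_0^{2π} ψ(e^{iθ})² dθ ≤ ∫_𝔻 ‖∇ψ‖² dA. -/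
open MeasureTheory Real

/-- **Wirtinger's inequality** for a function taking equal values at the endpoints. -/
theorem wirtinger_inequality {a b : ℝ} (hab : a < b) {f f' : ℝ → ℝ}
    (hf : ∀ x, HasDerivAt f (f' x) x) (hf' : Continuous f') (hper : f a = f b) :
    (∫ x in a..b, f x ^ 2) - (b - a)⁻¹ * (∫ x in a..b, f x) ^ 2
      ≤ ((b - a) / (2 * π)) ^ 2 * ∫ x in a..b, f' x ^ 2 := by
  have hT : 0 < b - a := sub_pos.2 hab
  have hfc : Continuous f := continuous_iff_continuousAt.2 fun x => (hf x).continuousAt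
  have memLp {g : ℝ → ℝ} (hg : Continuous g) :
      MemLp (fun x => (g x : ℂ)) 2 (volume.restrict (Set.Ioc a b)) := by
    have hgc : Continuous fun x => (g x : ℂ) := Complex.continuous_ofReal.comp hg
    obtain ⟨C, hC⟩ := (isCompact_Icc (a := a) (b := b)).exists_bound_of_continuousOn hgc.continuousOn
    exact MemLp.of_bound hgc.aestronglyMeasurable C
      ((ae_restrict_iff' measurableSet_Ioc).2
        (ae_of_all _ fun x hx => hC x (Set.Ioc_subset_Icc_self hx)))
  have parseval {g : ℝ → ℝ} (hg : Continuous g) :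
      HasSum (fun n => ‖fourierCoeffOn hab (fun x => (g x : ℂ)) n‖ ^ 2)
        ((b - a)⁻¹ * ∫ x in a..b, g x ^ 2) := by
    simpa [Complex.norm_real] using hasSum_sq_fourierCoeffOn hab (memLp hg)
  have hzero : ‖fourierCoeffOn hab (fun x => (f x : ℂ)) 0‖ ^ 2
      = (b - a)⁻¹ ^ 2 * (∫ x in a..b, f x) ^ 2 := by
    rw [fourierCoeffOn_eq_integral]
    simp [intervalIntegral.integral_ofReal, mul_pow, -Complex.ofReal_sub, Complex.norm_real]
  have hcoeff (n : ℤ) (hn : n ≠ 0) : ‖fourierCoeffOn hab (fun x => (f x : ℂ)) n‖ ^ 2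
      ≤ ((b - a) / (2 * π)) ^ 2 * ‖fourierCoeffOn hab (fun x => (f' x : ℂ)) n‖ ^ 2 := by
    rw [fourierCoeffOn_of_hasDerivAt hab hn (fun x _ => (hf x).ofReal_comp)
      ((Complex.continuous_ofReal.comp hf').intervalIntegrable _ _), hper, sub_self, mul_zero,
      zero_sub, mul_neg, norm_neg, ← mul_assoc, norm_mul, mul_pow]
    gcongr
    have hn1 : (1 : ℝ) ≤ |(n : ℝ)| := by exact_mod_cast Int.one_le_abs hn
    rw [← Complex.ofReal_sub]
    simp only [norm_mul, norm_div, norm_neg, Complex.norm_real, Complex.norm_I,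
      Complex.norm_intCast, Real.norm_eq_abs, abs_of_pos hT, abs_of_pos pi_pos, Complex.norm_ofNat,
      mul_one, one_div_mul_eq_div]
    exact div_le_div_of_nonneg_left hT.le two_pi_pos (le_mul_of_one_le_right two_pi_pos.le hn1)
  have key := hasSum_le (fun n => ?_) (parseval hfc)
    ((hasSum_ite_eq (0 : ℤ) ((b - a)⁻¹ ^ 2 * (∫ x in a..b, f x) ^ 2)).add
      ((parseval hf').mul_left (((b - a) / (2 * π)) ^ 2)))
  · have h := mul_le_mul_of_nonneg_left key hT.le
    have h1 : (b - a) * (b - a)⁻¹ = 1 := mul_inv_cancel₀ hT.ne'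
    linear_combination h - (∫ x in a..b, f x ^ 2) * h1 + (b - a)⁻¹ * (∫ x in a..b, f x) ^ 2 * h1
      + ((b - a) / (2 * π)) ^ 2 * (∫ x in a..b, f' x ^ 2) * h1
  · by_cases hn : n = 0
    · subst hn
      simp only [hzero, if_true]
      exact le_add_of_nonneg_right (by positivity)
    · simpa [hn] using hcoeff n hn

/-- Differentiation under an interval integral for jointly continuous data. -/
theorem hasDerivAt_intervalIntegral_of_continuous {F F' : ℝ → ℝ → ℝ} {a b : ℝ}
    (hF : Continuous (Function.uncurry F)) (hF' : Continuous (Function.uncurry F'))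
    (h : ∀ x t, HasDerivAt (fun x => F x t) (F' x t) x) (x₀ : ℝ) :
    HasDerivAt (fun x => ∫ t in a..b, F x t) (∫ t in a..b, F' x₀ t) x₀ := by
  obtain ⟨C, hC⟩ := ((isCompact_closedBall x₀ 1).prod
    (isCompact_uIcc (a := a) (b := b))).exists_bound_of_continuousOn hF'.continuousOn
  refine (intervalIntegral.hasDerivAt_integral_of_dominated_loc_of_deriv_le
    (bound := fun _ => C) (Metric.closedBall_mem_nhds x₀ one_pos)
    (.of_forall fun x => (hF.uncurry_left x).aestronglyMeasurable)
    ((hF.uncurry_left x₀).intervalIntegrable _ _) (hF'.uncurry_left x₀).aestronglyMeasurable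
    (ae_of_all _ fun t ht x hx => hC (x, t) ⟨hx, Set.uIoc_subset_uIcc ht⟩)
    (by simp) (ae_of_all _ fun t _ x _ => h x t)).2

/-- Integration over the unit disk in polar coordinates. -/
theorem integral_ball_eq_integral_polar {f : ℂ → ℝ} (hf : Continuous f) :
    ∫ z in Metric.ball (0 : ℂ) 1, f z
      = ∫ r in (0 : ℝ)..1, r * ∫ θ in (0 : ℝ)..(2 * π), f (r * Complex.exp (θ * Complex.I)) := by
  have hg : Continuous fun p : ℝ × ℝ => p.1 * f (p.1 * Complex.exp (p.2 * Complex.I)) := by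
    fun_prop
  have hint : IntegrableOn (fun p : ℝ × ℝ => p.1 * f (p.1 * Complex.exp (p.2 * Complex.I)))
      (Set.Ioo (0 : ℝ) 1 ×ˢ Set.Ioo (-π) π) :=
    (hg.continuousOn.integrableOn_compact (isCompact_Icc.prod isCompact_Icc)).mono_set
      (Set.prod_mono Set.Ioo_subset_Icc_self Set.Ioo_subset_Icc_self)
  have hper (r : ℝ) : ∫ θ in Set.Ioo (-π) π, f (r * Complex.exp (θ * Complex.I))
      = ∫ θ in (0 : ℝ)..(2 * π), f (r * Complex.exp (θ * Complex.I)) := by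
    have hp : Function.Periodic (fun θ : ℝ => f (r * Complex.exp (θ * Complex.I))) (2 * π) := by
      intro θ
      have : ((θ + 2 * π : ℝ) : ℂ) * Complex.I = θ * Complex.I + 2 * π * Complex.I := by
        push_cast; ring
      simp only [this, Complex.exp_periodic _]
    rw [← integral_Ioc_eq_integral_Ioo,
      ← intervalIntegral.integral_of_le (by linarith [pi_pos] : -π ≤ π)]
    simpa [two_mul] using hp.intervalIntegral_add_eq (-π) 0
  rw [← integral_indicator measurableSet_ball, ← Complex.integral_comp_polarCoord_symm,
    intervalIntegral.integral_of_le zero_le_one, integral_Ioc_eq_integral_Ioo]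
  calc _ = ∫ p in Set.Ioi (0 : ℝ) ×ˢ Set.Ioo (-π) π,
        (Set.Ioo (0 : ℝ) 1 ×ˢ Set.Ioo (-π) π).indicator
          (fun p : ℝ × ℝ => p.1 * f (p.1 * Complex.exp (p.2 * Complex.I))) p := by
        refine setIntegral_congr_fun (measurableSet_Ioi.prod measurableSet_Ioo) fun p hp => ?_
        have h0 : 0 < p.1 := hp.1
        have hmem : Complex.polarCoord.symm p ∈ Metric.ball (0 : ℂ) 1 ↔
            p ∈ Set.Ioo (0 : ℝ) 1 ×ˢ Set.Ioo (-π) π := by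
          rw [mem_ball_zero_iff, Complex.norm_polarCoord_symm, abs_of_pos h0]
          exact ⟨fun h => ⟨⟨h0, h⟩, hp.2⟩, fun h => h.1.2⟩
        have hval : Complex.polarCoord.symm p = p.1 * Complex.exp (p.2 * Complex.I) := by
          rw [Complex.polarCoord_symm_apply, Complex.exp_mul_I]
          push_cast; rfl
        by_cases hp1 : p ∈ Set.Ioo (0 : ℝ) 1 ×ˢ Set.Ioo (-π) π
        · rw [Set.indicator_of_mem hp1, Set.indicator_of_mem (hmem.2 hp1), smul_eq_mul, hval]
        · rw [Set.indicator_of_notMem hp1, Set.indicator_of_notMem (mt hmem.1 hp1), smul_zero]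
    _ = ∫ p in Set.Ioo (0 : ℝ) 1 ×ˢ Set.Ioo (-π) π,
          p.1 * f (p.1 * Complex.exp (p.2 * Complex.I)) := by
        rw [setIntegral_indicator (measurableSet_Ioo.prod measurableSet_Ioo),
          Set.inter_eq_right.2 (Set.prod_mono Set.Ioo_subset_Ioi_self subset_rfl)]
    _ = _ := by
        rw [Measure.volume_eq_prod] at hint ⊢
        rw [setIntegral_prod _ hint]
        simp only [integral_const_mul, hper]

/-- Bessel's inequality for a real functional on `ℂ` in the orthonormal frame `w, I * w`. -/
theorem Complex.sq_apply_add_sq_apply_I_mul_le (L : ℂ →L[ℝ] ℝ) {w : ℂ} (hw : ‖w‖ = 1) :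
    L w ^ 2 + L (Complex.I * w) ^ 2 ≤ ‖L‖ ^ 2 := by
  set x := L w
  set y := L (Complex.I * w)
  have hL : L ((x + y * Complex.I) * w) = x ^ 2 + y ^ 2 := by
    have : (x + y * Complex.I) * w = x • w + y • (Complex.I * w) := by
      simp only [Complex.real_smul]; ring
    rw [this, map_add, map_smul, map_smul, smul_eq_mul, smul_eq_mul]
    ring
  have hn : ‖(x + y * Complex.I) * w‖ ^ 2 = x ^ 2 + y ^ 2 := by
    rw [norm_mul, hw, mul_one, Complex.sq_norm, Complex.normSq_add_mul_I]
  have hle := L.le_opNorm ((x + y * Complex.I) * w)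
  rw [hL, Real.norm_of_nonneg (by positivity)] at hle
  have hsq := pow_le_pow_left₀ (by positivity) hle 2
  rw [mul_pow, hn] at hsq
  rcases (by positivity : 0 ≤ x ^ 2 + y ^ 2).eq_or_lt with h | h
  · rw [← h]; positivity
  · nlinarith

/-- The boundary variance of a `C¹` function on `ℂ` is at most its Dirichlet energy on the disk. -/
theorem boundary_variance_le_dirichlet_energy {ψ : ℂ → ℝ} (hψ : ContDiff ℝ 1 ψ) :
    (∫ θ in (0 : ℝ)..(2 * π), ψ (Complex.exp (θ * Complex.I)) ^ 2)
        - (2 * π)⁻¹ * (∫ θ in (0 : ℝ)..(2 * π), ψ (Complex.exp (θ * Complex.I))) ^ 2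
      ≤ ∫ z in Metric.ball (0 : ℂ) 1, ‖fderiv ℝ ψ z‖ ^ 2 := by
  have hD : Continuous (fderiv ℝ ψ) := hψ.continuous_fderiv one_ne_zero
  have hc : Continuous ψ := hψ.continuous
  have hdiff : Differentiable ℝ ψ := hψ.differentiable one_ne_zero
  set E : ℝ → ℂ := fun θ => Complex.exp (θ * Complex.I) with hE
  have hEc : Continuous E := by fun_prop
  have hEn (θ : ℝ) : ‖E θ‖ = 1 := Complex.norm_exp_ofReal_mul_I θ
  set u : ℝ → ℝ → ℝ := fun r θ => ψ (r * E θ) with hu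
  set ur : ℝ → ℝ → ℝ := fun r θ => fderiv ℝ ψ (r * E θ) (E θ) with hur
  set uθ : ℝ → ℝ → ℝ := fun r θ => fderiv ℝ ψ (r * E θ) (r * (Complex.I * E θ)) with huθ
  have huc : Continuous (Function.uncurry u) := by
    simp only [hu, Function.uncurry_def]; fun_prop
  have hurc : Continuous (Function.uncurry ur) := by
    simp only [hur, Function.uncurry_def]; fun_prop
  have huθc : Continuous (Function.uncurry uθ) := by
    simp only [huθ, Function.uncurry_def]; fun_prop
  have hder_r (r θ : ℝ) : HasDerivAt (fun r => u r θ) (ur r θ) r := by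
    have h : HasDerivAt (fun r : ℝ => (r : ℂ) * E θ) (E θ) r := by
      simpa using (hasDerivAt_id r).ofReal_comp.mul_const (E θ)
    exact (hdiff _).hasFDerivAt.comp_hasDerivAt r h
  have hder_θ (r θ : ℝ) : HasDerivAt (u r) (uθ r θ) θ := by
    have h : HasDerivAt (fun θ : ℝ => (r : ℂ) * E θ) (r * (Complex.I * E θ)) θ := by
      have := (((hasDerivAt_id θ).ofReal_comp.mul_const Complex.I).cexp).const_mul (r : ℂ)
      simpa [hE, mul_comm] using this
    exact (hdiff _).hasFDerivAt.comp_hasDerivAt θ h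
  set B : ℝ → ℝ := fun r => (∫ θ in (0 : ℝ)..(2 * π), u r θ ^ 2)
    - (2 * π)⁻¹ * (∫ θ in (0 : ℝ)..(2 * π), u r θ) ^ 2 with hB
  set B' : ℝ → ℝ := fun r => (∫ θ in (0 : ℝ)..(2 * π), 2 * u r θ * ur r θ)
    - (2 * π)⁻¹ * (2 * (∫ θ in (0 : ℝ)..(2 * π), u r θ) * ∫ θ in (0 : ℝ)..(2 * π), ur r θ)
    with hB'
  set K : ℝ → ℝ := fun r => r * ∫ θ in (0 : ℝ)..(2 * π), ‖fderiv ℝ ψ (r * E θ)‖ ^ 2 with hK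
  have hBder (r : ℝ) : HasDerivAt B (B' r) r := by
    have h1 := hasDerivAt_intervalIntegral_of_continuous (a := 0) (b := 2 * π)
      (F := fun r θ => u r θ ^ 2) (F' := fun r θ => 2 * u r θ * ur r θ)
      (by simpa only [Function.uncurry_def] using huc.fun_pow 2) ((huc.const_mul 2).mul hurc)
      (fun r θ => by simpa using (hder_r r θ).fun_pow 2) r
    have h2 := hasDerivAt_intervalIntegral_of_continuous (a := 0) (b := 2 * π) huc hurc hder_r r
    simpa only [Nat.cast_ofNat, Nat.add_one_sub_one, pow_one] using
      h1.fun_sub ((h2.fun_pow 2).const_mul (2 * π)⁻¹)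
  have hB'c : Continuous B' := by
    have h1 := intervalIntegral.continuous_parametric_intervalIntegral_of_continuous' (μ := volume)
      (f := fun r θ => 2 * u r θ * ur r θ) ((huc.const_mul 2).mul hurc) 0 (2 * π)
    have h2 := intervalIntegral.continuous_parametric_intervalIntegral_of_continuous' (μ := volume)
      huc 0 (2 * π)
    have h3 := intervalIntegral.continuous_parametric_intervalIntegral_of_continuous' (μ := volume)
      hurc 0 (2 * π)
    exact h1.sub (((h2.const_mul 2).mul h3).const_mul _)
  have hKc : Continuous K := by
    refine continuous_id.mul
      (intervalIntegral.continuous_parametric_intervalIntegral_of_continuous' ?_ 0 (2 * π))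
    simp only [Function.uncurry_def]; fun_prop
  have hle (r : ℝ) (hr : 0 < r) : B' r ≤ K r := by
    have cu := huc.uncurry_left r
    have cur := hurc.uncurry_left r
    have cuθ := huθc.uncurry_left r
    have cD : Continuous fun θ => ‖fderiv ℝ ψ (r * E θ)‖ ^ 2 := by fun_prop
    have hw := wirtinger_inequality two_pi_pos (hder_θ r) cuθ (by simp [hu, hE])
    rw [sub_zero, div_self two_pi_pos.ne', one_pow, one_mul] at hw
    have hbessel : (∫ θ in (0 : ℝ)..(2 * π), uθ r θ ^ 2)
        + r ^ 2 * (∫ θ in (0 : ℝ)..(2 * π), ur r θ ^ 2) ≤ r * K r := by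
      rw [hK, ← mul_assoc, ← sq, ← intervalIntegral.integral_const_mul,
        ← intervalIntegral.integral_const_mul, ← intervalIntegral.integral_add
          ((cuθ.fun_pow 2).intervalIntegrable _ _) (((cur.fun_pow 2).const_mul _).intervalIntegrable _ _)]
      refine intervalIntegral.integral_mono_on two_pi_pos.le
        (((cuθ.fun_pow 2).add ((cur.fun_pow 2).const_mul _)).intervalIntegrable _ _)
        ((cD.const_mul _).intervalIntegrable _ _) fun θ _ => ?_
      have hθ : uθ r θ = r * fderiv ℝ ψ (r * E θ) (Complex.I * E θ) := by
        simp only [huθ]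
        rw [← Complex.real_smul (x := r) (z := Complex.I * E θ), map_smul, smul_eq_mul]
      have := mul_le_mul_of_nonneg_left
        (Complex.sq_apply_add_sq_apply_I_mul_le (fderiv ℝ ψ (r * E θ)) (hEn θ)) (sq_nonneg r)
      rw [hθ]
      linarith
    set m := (2 * π)⁻¹ * ∫ θ in (0 : ℝ)..(2 * π), u r θ with hm
    have hsq : 0 ≤ ∫ θ in (0 : ℝ)..(2 * π), (u r θ - m - r * ur r θ) ^ 2 :=
      intervalIntegral.integral_nonneg two_pi_pos.le fun θ _ => sq_nonneg _
    have hexp : (∫ θ in (0 : ℝ)..(2 * π), (u r θ - m - r * ur r θ) ^ 2)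
        = (∫ θ in (0 : ℝ)..(2 * π), u r θ ^ 2) + r ^ 2 * (∫ θ in (0 : ℝ)..(2 * π), ur r θ ^ 2)
          + 2 * π * m ^ 2 - r * (∫ θ in (0 : ℝ)..(2 * π), 2 * u r θ * ur r θ)
          - 2 * m * (∫ θ in (0 : ℝ)..(2 * π), u r θ)
          + 2 * m * r * (∫ θ in (0 : ℝ)..(2 * π), ur r θ) := by
      have : ∀ θ, (u r θ - m - r * ur r θ) ^ 2 = u r θ ^ 2 + r ^ 2 * ur r θ ^ 2 + m ^ 2
          - r * (2 * u r θ * ur r θ) - 2 * m * u r θ + 2 * m * r * ur r θ := fun θ => by ring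
      have i1 := cu.fun_pow 2
      have i2 := (cur.fun_pow 2).const_mul (r ^ 2)
      have i4 := ((cu.const_mul 2).fun_mul cur).const_mul r
      have i5 := cu.const_mul (2 * m)
      have i6 := cur.const_mul (2 * m * r)
      simp only [this]
      rw [intervalIntegral.integral_add ?_ (i6.intervalIntegrable _ _),
        intervalIntegral.integral_sub ?_ (i5.intervalIntegrable _ _),
        intervalIntegral.integral_sub ?_ (i4.intervalIntegrable _ _),
        intervalIntegral.integral_add ?_ intervalIntegrable_const,
        intervalIntegral.integral_add (i1.intervalIntegrable _ _) (i2.intervalIntegrable _ _)]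
      · simp only [intervalIntegral.integral_const_mul, intervalIntegral.integral_const, sub_zero,
          smul_eq_mul]
      · exact (i1.add i2).intervalIntegrable _ _
      · exact ((i1.add i2).add continuous_const).intervalIntegrable _ _
      · exact (((i1.add i2).add continuous_const).sub i4).intervalIntegrable _ _
      · exact ((((i1.add i2).add continuous_const).sub i4).sub i5).intervalIntegrable _ _
    have hm' : (∫ θ in (0 : ℝ)..(2 * π), u r θ) = 2 * π * m := by
      rw [hm, mul_inv_cancel_left₀ two_pi_pos.ne']
    have hB'm : B' r = (∫ θ in (0 : ℝ)..(2 * π), 2 * u r θ * ur r θ)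
        - 2 * m * ∫ θ in (0 : ℝ)..(2 * π), ur r θ := by
      simp only [hB', hm]; ring
    have hvar : (2 * π)⁻¹ * (∫ θ in (0 : ℝ)..(2 * π), u r θ) ^ 2 = 2 * π * m ^ 2 := by
      rw [hm']; field_simp
    rw [hvar] at hw
    rw [hexp, hm'] at hsq
    refine le_of_mul_le_mul_left ?_ hr
    rw [hB'm]
    linarith
  have hftc : ∫ r in (0 : ℝ)..1, B' r = B 1 - B 0 :=
    intervalIntegral.integral_eq_sub_of_hasDerivAt (fun r _ => hBder r)
      (hB'c.intervalIntegrable _ _)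
  have hB0 : B 0 = 0 := by
    simp only [hB, hu, Complex.ofReal_zero, zero_mul, intervalIntegral.integral_const, sub_zero,
      smul_eq_mul]
    field_simp
    ring
  have hmono : ∫ r in (0 : ℝ)..1, B' r ≤ ∫ r in (0 : ℝ)..1, K r :=
    intervalIntegral.integral_mono_on_of_le_Ioo zero_le_one (hB'c.intervalIntegrable _ _)
      (hKc.intervalIntegrable _ _) fun r hr => hle r hr.1
  rw [integral_ball_eq_integral_polar (f := fun z => ‖fderiv ℝ ψ z‖ ^ 2) (by fun_prop)]
  calc _ = B 1 := by simp only [hB, hu, hE, Complex.ofReal_one, one_mul]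
    _ = ∫ r in (0 : ℝ)..1, B' r := by rw [hftc, hB0, sub_zero]
    _ ≤ _ := hmono

/-- A `C¹` function near the closed unit disk agrees on the disk with a globally `C¹` function. -/
theorem exists_contDiff_eqOn_closedBall {ψ : ℂ → ℝ} {U : Set ℂ} (hU : IsOpen U)
    (hsub : Metric.closedBall (0 : ℂ) 1 ⊆ U) (hψ : ContDiffOn ℝ 1 ψ U) :
    ∃ φ : ℂ → ℝ, ContDiff ℝ 1 φ ∧ Set.EqOn φ ψ (Metric.closedBall 0 1) := by
  obtain ⟨δ, hδ, hδU⟩ := (isCompact_closedBall (0 : ℂ) 1).exists_cthickening_subset_open hU hsub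
  rw [cthickening_closedBall hδ.le zero_le_one] at hδU
  let χ : ContDiffBump (0 : ℂ) := ⟨1, δ + 1, one_pos, by linarith⟩
  refine ⟨fun z => χ z * ψ z, contDiff_iff_contDiffAt.2 fun z => ?_, fun z hz => ?_⟩
  · by_cases hz : z ∈ U
    · exact χ.contDiff.contDiffAt.mul (hψ.contDiffAt (hU.mem_nhds hz))
    · have hzs : z ∉ tsupport χ := fun h => hz (hδU (by rwa [χ.tsupport_eq] at h))
      refine (contDiffAt_const (c := (0 : ℝ))).congr_of_eventuallyEq ?_
      filter_upwards [notMem_tsupport_iff_eventuallyEq.1 hzs] with y hy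
      simp [hy]
  · simp [χ.one_of_mem_closedBall hz]

/-- Nonnegativity of the form `Q₀` on functions with zero boundary average: if `ψ` is `C¹`
on a neighborhood of the closed unit disk and `∫_0^{2π} ψ(e^{iθ}) dθ = 0`, then
`∫_0^{2π} ψ(e^{iθ})² dθ ≤ ∫_𝔻 ‖∇ψ‖² dA`, i.e. `Q₀(ψ) ≥ 0`. -/
theorem Q0_nonneg_of_zero_boundary_average
    (ψ : ℂ → ℝ)
    (hψ : ∃ U : Set ℂ, IsOpen U ∧ Metric.closedBall (0:ℂ) 1 ⊆ U ∧ ContDiffOn ℝ 1 ψ U)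
    (havg : (∫ θ in (0:ℝ)..(2 * π), ψ (Complex.exp (θ * Complex.I))) = 0) :
    (∫ θ in (0:ℝ)..(2 * π), (ψ (Complex.exp (θ * Complex.I))) ^ 2)
      ≤ ∫ z in Metric.ball (0:ℂ) 1, ‖fderiv ℝ ψ z‖ ^ 2 := by
  obtain ⟨U, hU, hsub, hψU⟩ := hψ
  obtain ⟨φ, hφ, heq⟩ := exists_contDiff_eqOn_closedBall hU hsub hψU
  have hbdry (θ : ℝ) : φ (Complex.exp (θ * Complex.I)) = ψ (Complex.exp (θ * Complex.I)) :=
    heq (by simp [Complex.norm_exp_ofReal_mul_I])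
  have hint : ∫ z in Metric.ball (0 : ℂ) 1, ‖fderiv ℝ φ z‖ ^ 2
      = ∫ z in Metric.ball (0 : ℂ) 1, ‖fderiv ℝ ψ z‖ ^ 2 := by
    refine setIntegral_congr_fun measurableSet_ball fun z hz => ?_
    have : φ =ᶠ[nhds z] ψ := Filter.eventuallyEq_of_mem (Metric.isOpen_ball.mem_nhds hz)
      (heq.mono Metric.ball_subset_closedBall)
    simp only [this.fderiv_eq]
  have h := boundary_variance_le_dirichlet_energy hφ
  simpa only [hbdry, havg, hint, zero_pow two_ne_zero, mul_zero, sub_zero] using h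
end

section
/- Let V be a real vector space, Q : V × V → ℝ a symmetric bilinear form, m ≥ 1 an integer, and 0 ≤ ε < 1/m. Suppose φ₁, …, φ_m ∈ V satisfy |Q(φ_i, φ_j) + δ_{ij}| ≤ ε for all i, j ∈ {1, …, m}, where δ_{ij} is the Kronecker delta. Then φ₁, …, φ_m are linearly independent and Q(x, x) < 0 for every nonzero x in the span of φ₁, …, φ_m. -/
/-- If the Gram matrix of `φ` with respect to `-Q` is entrywise `ε`-close to the identity, then
`Q` is bounded above on linear combinations of `φ` by `ε * card ι - 1` times the squared
Euclidean norm of the coefficients. -/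
theorem bilin_sum_smul_self_le
    {ι V : Type*} [Fintype ι] [DecidableEq ι] [AddCommGroup V] [Module ℝ V]
    (Q : V →ₗ[ℝ] V →ₗ[ℝ] ℝ) {ε : ℝ} (hε : 0 ≤ ε) (φ : ι → V)
    (hgram : ∀ i j, |Q (φ i) (φ j) + (if i = j then (1 : ℝ) else 0)| ≤ ε) (c : ι → ℝ) :
    Q (∑ i, c i • φ i) (∑ i, c i • φ i) ≤ (ε * Fintype.card ι - 1) * ∑ i, c i ^ 2 := by
  have hexp : Q (∑ i, c i • φ i) (∑ i, c i • φ i)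
      = ∑ i, ∑ j, c i * c j * (Q (φ i) (φ j) + (if i = j then (1 : ℝ) else 0))
        - ∑ i, c i ^ 2 := by
    simp [mul_add, Finset.sum_add_distrib, Finset.mul_sum, mul_assoc, sq]
    rw [Finset.sum_comm]
    exact Finset.sum_congr rfl fun i _ ↦ Finset.sum_congr rfl fun j _ ↦ mul_left_comm _ _ _
  have hbound : ∑ i, ∑ j, c i * c j * (Q (φ i) (φ j) + (if i = j then (1 : ℝ) else 0))
      ≤ ε * (∑ i, |c i|) ^ 2 := by
    rw [sq, Finset.sum_mul_sum, Finset.mul_sum]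
    refine Finset.sum_le_sum fun i _ ↦ ?_
    rw [Finset.mul_sum]
    refine Finset.sum_le_sum fun j _ ↦ (le_abs_self _).trans ?_
    rw [abs_mul, abs_mul, mul_comm ε]
    exact mul_le_mul_of_nonneg_left (hgram i j) (by positivity)
  have hcs : (∑ i, |c i|) ^ 2 ≤ Fintype.card ι * ∑ i, c i ^ 2 := by
    simpa using sq_sum_le_card_mul_sum_sq (s := Finset.univ) (f := fun i ↦ |c i|)
  linarith [mul_le_mul_of_nonneg_left hcs hε]

/-- If the Gram matrix of `φ₁, …, φ_m` with respect to `−Q` is `ε`-close to the identity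
entrywise, with `0 ≤ ε < 1/m`, then `φ₁, …, φ_m` are linearly independent and `Q` is
negative definite on their span. -/
theorem almost_orthonormal_negative_definite
    {V : Type*} [AddCommGroup V] [Module ℝ V]
    (Q : V →ₗ[ℝ] V →ₗ[ℝ] ℝ) (hsym : ∀ x y : V, Q x y = Q y x)
    (m : ℕ) (hm : 1 ≤ m) (ε : ℝ) (hε0 : 0 ≤ ε) (hε : ε < 1 / m)
    (φ : Fin m → V)
    (hgram : ∀ i j : Fin m, |Q (φ i) (φ j) + (if i = j then (1:ℝ) else 0)| ≤ ε) :
    LinearIndependent ℝ φ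
      ∧ ∀ x ∈ Submodule.span ℝ (Set.range φ), x ≠ 0 → Q x x < 0 := by
  have hεm : ε * m - 1 < 0 := by
    have hm0 : (0 : ℝ) < m := by exact_mod_cast hm
    linarith [(lt_div_iff₀ hm0).1 hε]
  have hneg (c : Fin m → ℝ) (hc : c ≠ 0) : Q (∑ i, c i • φ i) (∑ i, c i • φ i) < 0 := by
    obtain ⟨k, hk⟩ := Function.ne_iff.1 hc
    have hpos : 0 < ∑ i, c i ^ 2 :=
      Finset.sum_pos' (fun i _ ↦ sq_nonneg _) ⟨k, Finset.mem_univ k, sq_pos_of_ne_zero hk⟩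
    have hle := bilin_sum_smul_self_le Q hε0 φ hgram c
    rw [Fintype.card_fin] at hle
    exact hle.trans_lt (mul_neg_of_neg_of_pos hεm hpos)
  constructor
  · refine Fintype.linearIndependent_iff.2 fun c hc ↦ congrFun (?_ : c = 0)
    by_contra hne
    simpa [hc] using hneg c hne
  · intro x hx hx0
    obtain ⟨c, rfl⟩ := (Submodule.mem_span_range_iff_exists_fun ℝ).1 hx
    exact hneg c fun h ↦ hx0 (by simp [h])
end

section
/- Let α : ℝ → ℝ² be twice continuously differentiable with ‖α'(s)‖ = 1 for all s ∈ ℝ, α(0) = (0, 0), and α'(0) = (1, 0). Suppose there is a continuous function κ : ℝ → ℝ with α''(s) = κ(s)·(−α₂'(s), α₁'(s)) for all s, such that κ(s) ≥ 0 for all s ≥ 0 and ∫_0^s κ(t) dt ≤ ε for all s ≥ 0, where 0 < ε < π/2. Then for every s ≥ 0: α₁'(s) ≥ cos ε > 0, α₂'(s) ≥ 0, and α(s) lies in the closed first quadrant, i.e. α₁(s) ≥ 0 and α₂(s) ≥ 0. -/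
open Real

/-- Solutions of the planar rotation system with angular speed `θ'` that start at angle `θ 0`
on the unit circle stay at angle `θ`. -/
theorem eq_cos_sin_of_hasDerivAt {u v θ κ : ℝ → ℝ}
    (hu : ∀ s, HasDerivAt u (κ s * (-(v s))) s) (hv : ∀ s, HasDerivAt v (κ s * u s) s)
    (hθ : ∀ s, HasDerivAt θ (κ s) s) (hu0 : u 0 = cos (θ 0)) (hv0 : v 0 = sin (θ 0)) (s : ℝ) :
    u s = cos (θ s) ∧ v s = sin (θ s) := by
  have hG : ∀ x, HasDerivAt (fun t => (u t - cos (θ t)) ^ 2 + (v t - sin (θ t)) ^ 2) 0 x := by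
    intro x
    refine ((((hu x).sub (hθ x).cos).pow 2).add
      (((hv x).sub (hθ x).sin).pow 2)).congr_deriv ?_
    simp only [Pi.sub_apply]
    ring
  have hs := is_const_of_deriv_eq_zero (fun x => (hG x).differentiableAt)
    (fun x => (hG x).deriv) s 0
  simp only [hu0, hv0, sub_self] at hs
  constructor <;> nlinarith [sq_nonneg (u s - cos (θ s)), sq_nonneg (v s - sin (θ s))]

/-- A differentiable function vanishing at `0` with nonnegative derivative on `[0,∞)` is
nonnegative there. -/
theorem nonneg_of_deriv_nonneg_Ici {f : ℝ → ℝ} (hf : Differentiable ℝ f) (h0 : f 0 = 0)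
    (hf' : ∀ s, 0 ≤ s → 0 ≤ deriv f s) {s : ℝ} (hs : 0 ≤ s) : 0 ≤ f s := by
  have hmono : MonotoneOn f (Set.Ici 0) :=
    monotoneOn_of_deriv_nonneg (convex_Ici 0) hf.continuous.continuousOn hf.differentiableOn
      fun x hx => hf' x (interior_subset hx)
  exact h0 ▸ hmono Set.self_mem_Ici hs hs

/-- A unit-speed planar curve starting at the origin in the direction `(1,0)`, with
nonnegative signed curvature of total integral at most `ε < π/2` on `[0,∞)`, has tangent
satisfying `α₁' ≥ cos ε > 0` and `α₂' ≥ 0`, and stays in the closed first quadrant, for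
all arclength parameters `s ≥ 0`. -/
theorem curve_small_total_curvature_in_quadrant
    (α₁ α₂ : ℝ → ℝ) (h₁ : ContDiff ℝ 2 α₁) (h₂ : ContDiff ℝ 2 α₂)
    (hunit : ∀ s, (deriv α₁ s) ^ 2 + (deriv α₂ s) ^ 2 = 1)
    (h0 : α₁ 0 = 0 ∧ α₂ 0 = 0)
    (hd0 : deriv α₁ 0 = 1 ∧ deriv α₂ 0 = 0)
    (κ : ℝ → ℝ) (hκc : Continuous κ)
    (hcurv₁ : ∀ s, deriv (deriv α₁) s = κ s * (-(deriv α₂ s)))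
    (hcurv₂ : ∀ s, deriv (deriv α₂) s = κ s * deriv α₁ s)
    (ε : ℝ) (hε0 : 0 < ε) (hεπ : ε < π / 2)
    (hκ0 : ∀ s, 0 ≤ s → 0 ≤ κ s)
    (hκint : ∀ s, 0 ≤ s → (∫ t in (0:ℝ)..s, κ t) ≤ ε) :
    0 < Real.cos ε
      ∧ ∀ s, 0 ≤ s →
          Real.cos ε ≤ deriv α₁ s ∧ 0 ≤ deriv α₂ s ∧ 0 ≤ α₁ s ∧ 0 ≤ α₂ s := by
  have hcos : 0 < cos ε := cos_pos_of_mem_Ioo ⟨by linarith [pi_pos], hεπ⟩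
  have hd₁ : Differentiable ℝ (deriv α₁) :=
    (contDiff_succ_iff_deriv (n := 1).1 h₁).2.2.differentiable one_ne_zero
  have hd₂ : Differentiable ℝ (deriv α₂) :=
    (contDiff_succ_iff_deriv (n := 1).1 h₂).2.2.differentiable one_ne_zero
  have htangent := eq_cos_sin_of_hasDerivAt (θ := fun s => ∫ t in (0:ℝ)..s, κ t)
    (fun s => hcurv₁ s ▸ (hd₁ s).hasDerivAt) (fun s => hcurv₂ s ▸ (hd₂ s).hasDerivAt)
    (fun s => hκc.integral_hasStrictDerivAt 0 s |>.hasDerivAt)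
    (by simp [hd0.1]) (by simp [hd0.2])
  have hθ0 : ∀ s, 0 ≤ s → 0 ≤ ∫ t in (0:ℝ)..s, κ t := fun s hs =>
    intervalIntegral.integral_nonneg hs fun t ht => hκ0 t ht.1
  have hu : ∀ s, 0 ≤ s → cos ε ≤ deriv α₁ s := fun s hs => by
    rw [(htangent s).1]
    exact cos_le_cos_of_nonneg_of_le_pi (hθ0 s hs) (by linarith [pi_pos]) (hκint s hs)
  have hv : ∀ s, 0 ≤ s → 0 ≤ deriv α₂ s := fun s hs => by
    rw [(htangent s).2]
    exact sin_nonneg_of_nonneg_of_le_pi (hθ0 s hs) (by linarith [pi_pos, hκint s hs])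
  exact ⟨hcos, fun s hs => ⟨hu s hs, hv s hs,
    nonneg_of_deriv_nonneg_Ici (h₁.differentiable two_ne_zero) h0.1
      (fun t ht => hcos.le.trans (hu t ht)) hs,
    nonneg_of_deriv_nonneg_Ici (h₂.differentiable two_ne_zero) h0.2 hv hs⟩⟩
end

section
/- Let m ≥ 1 and for each i = 1, …, m let Sᵢ = { pᵢ + s·vᵢ + t·wᵢ : s, t > 0 } ⊆ ℝ², where pᵢ ∈ ℝ² and vᵢ, wᵢ are linearly independent unit vectors, and let βᵢ ∈ (0, π) be the angle between vᵢ and wᵢ (so cos βᵢ = ⟨vᵢ, wᵢ⟩). If the open sectors S₁, …, S_m are pairwise disjoint, then β₁ + ⋯ + β_m ≤ 2π. In particular, for 0 < ε < π/6 there do not exist three pairwise disjoint open sectors in ℝ² each of opening π − 2ε. -/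
open Real
open scoped InnerProductSpace

open Filter MeasureTheory

/-- The open sector with vertex `p` and edge directions `v`, `w`. -/
def openSector (p v w : EuclideanSpace ℝ (Fin 2)) : Set (EuclideanSpace ℝ (Fin 2)) :=
  {x | ∃ s t : ℝ, 0 < s ∧ 0 < t ∧ x = p + s • v + t • w}

theorem openSector_swap (p v w : EuclideanSpace ℝ (Fin 2)) :
    openSector p v w = openSector p w v := by
  ext x
  constructor <;> rintro ⟨s, t, hs, ht, rfl⟩ <;> exact ⟨t, s, ht, hs, by abel⟩

/-- The point of the unit circle with polar angle `θ`. -/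
noncomputable def circlePoint (θ : ℝ) : EuclideanSpace ℝ (Fin 2) := !₂[cos θ, sin θ]

theorem exists_circlePoint_eq {v : EuclideanSpace ℝ (Fin 2)} (hv : ‖v‖ = 1) :
    ∃ θ, v = circlePoint θ := by
  have h : v 0 ^ 2 + v 1 ^ 2 = 1 := by
    have := EuclideanSpace.real_norm_sq_eq v
    rw [hv, Fin.sum_univ_two] at this
    linarith
  have hz : ‖(⟨v 0, v 1⟩ : ℂ)‖ = 1 := by
    rw [← sq_eq_sq₀ (norm_nonneg _) zero_le_one, Complex.sq_norm, Complex.normSq_mk]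
    linarith
  have hz0 : (⟨v 0, v 1⟩ : ℂ) ≠ 0 := norm_ne_zero_iff.1 (by rw [hz]; exact one_ne_zero)
  refine ⟨Complex.arg ⟨v 0, v 1⟩, ?_⟩
  ext i
  fin_cases i
  · simp [circlePoint, Complex.cos_arg hz0, hz]
  · simp [circlePoint, Complex.sin_arg, hz]

theorem inner_circlePoint (a b : ℝ) : ⟪circlePoint a, circlePoint b⟫_ℝ = cos (a - b) := by
  simp [circlePoint, PiLp.inner_apply, Fin.sum_univ_two, cos_sub]
  ring

/-- The polar angles, modulo `2π`, strictly between `a` and `a + β`, for `0 < β < π`. -/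
def arcAngles (a β : ℝ) : Set ℝ := {θ | 0 < sin (θ - a) ∧ 0 < sin (a + β - θ)}

theorem isOpen_arcAngles (a β : ℝ) : IsOpen (arcAngles a β) :=
  (isOpen_lt (f := fun _ => 0) (g := fun θ => sin (θ - a)) (by fun_prop) (by fun_prop)).inter
    (isOpen_lt (f := fun _ => 0) (g := fun θ => sin (a + β - θ)) (by fun_prop) (by fun_prop))

theorem Ioo_subset_arcAngles {a β : ℝ} (hβ : β < π) : Set.Ioo a (a + β) ⊆ arcAngles a β :=
  fun _ hθ => ⟨sin_pos_of_pos_of_lt_pi (by linarith [hθ.1]) (by linarith [hθ.2]),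
    sin_pos_of_pos_of_lt_pi (by linarith [hθ.2]) (by linarith [hθ.1])⟩

theorem periodic_indicator_arcAngles (a β : ℝ) :
    Function.Periodic ((arcAngles a β).indicator fun _ => (1 : ℝ)) (2 * π) := by
  intro θ
  have h : θ + 2 * π ∈ arcAngles a β ↔ θ ∈ arcAngles a β := by
    simp only [arcAngles, Set.mem_ofPred_eq]
    rw [show θ + 2 * π - a = θ - a + 2 * π by ring, sin_add_two_pi,
      show a + β - (θ + 2 * π) = a + β - θ - 2 * π by ring, sin_sub_two_pi]
  by_cases hθ : θ ∈ arcAngles a β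
  · rw [Set.indicator_of_mem hθ, Set.indicator_of_mem (h.2 hθ)]
  · rw [Set.indicator_of_notMem hθ, Set.indicator_of_notMem (mt h.1 hθ)]

theorem intervalIntegrable_indicator_arcAngles (a β x y : ℝ) :
    IntervalIntegrable ((arcAngles a β).indicator fun _ => (1 : ℝ)) volume x y := by
  exact intervalIntegrable_iff.1 (intervalIntegrable_const (c := (1 : ℝ)))
    |>.indicator (isOpen_arcAngles a β).measurableSet |> intervalIntegrable_iff.2

theorem le_integral_indicator_arcAngles {a β : ℝ} (hβ : β ∈ Set.Ioo 0 π) :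
    β ≤ ∫ θ in 0..2 * π, (arcAngles a β).indicator (fun _ => (1 : ℝ)) θ := by
  have hper := (periodic_indicator_arcAngles a β).intervalIntegral_add_eq 0 a
  rw [zero_add] at hper
  rw [hper, ← intervalIntegral.integral_add_adjacent_intervals
    (intervalIntegrable_indicator_arcAngles a β a (a + β))
    (intervalIntegrable_indicator_arcAngles a β (a + β) (a + 2 * π))]
  have h₁ : ∫ θ in a..a + β, (arcAngles a β).indicator (fun _ => (1 : ℝ)) θ = β := by
    rw [intervalIntegral.integral_of_le (by linarith [hβ.1]), integral_Ioc_eq_integral_Ioo,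
      setIntegral_congr_fun measurableSet_Ioo
        fun θ hθ => Set.indicator_of_mem (Ioo_subset_arcAngles hβ.2 hθ) _]
    simp [hβ.1.le]
  have h₂ : 0 ≤ ∫ θ in (a + β)..(a + 2 * π), (arcAngles a β).indicator (fun _ => (1 : ℝ)) θ :=
    intervalIntegral.integral_nonneg (by linarith [hβ.1, hβ.2, pi_pos])
      fun θ _ => Set.indicator_nonneg (fun _ _ => zero_le_one) θ
  linarith

/-- A ray from the origin in a direction interior to a sector eventually enters the sector. -/
theorem eventually_smul_circlePoint_mem_openSector (p : EuclideanSpace ℝ (Fin 2)) {a β θ : ℝ}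
    (hβ : β ∈ Set.Ioo 0 π) (hθ : θ ∈ arcAngles a β) :
    ∀ᶠ R : ℝ in atTop,
      R • circlePoint θ ∈ openSector p (circlePoint a) (circlePoint (a + β)) := by
  have hD : 0 < sin β := sin_pos_of_pos_of_lt_pi hβ.1 hβ.2
  filter_upwards [
    (tendsto_id.atTop_mul_const hθ.1).eventually_gt_atTop (p 1 * cos a - p 0 * sin a),
    (tendsto_id.atTop_mul_const hθ.2).eventually_gt_atTop
      (p 0 * sin (a + β) - p 1 * cos (a + β))] with R h₁ h₂
  refine ⟨(R * sin (a + β - θ) - (p 0 * sin (a + β) - p 1 * cos (a + β))) / sin β,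
    (R * sin (θ - a) - (p 1 * cos a - p 0 * sin a)) / sin β,
    div_pos (sub_pos.2 h₂) hD, div_pos (sub_pos.2 h₁) hD, ?_⟩
  have hsin : sin β = sin (a + β) * cos a - cos (a + β) * sin a := by
    rw [← sin_sub, add_sub_cancel_left]
  ext i
  fin_cases i <;>
  · simp only [circlePoint, PiLp.add_apply, PiLp.smul_apply, smul_eq_mul, Fin.zero_eta,
      Fin.mk_one, Matrix.cons_val_zero, Matrix.cons_val_one]
    field_simp
    rw [sin_sub, sin_sub, hsin]
    ring

theorem exists_arcAngles {p v w : EuclideanSpace ℝ (Fin 2)} (hv : ‖v‖ = 1) (hw : ‖w‖ = 1)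
    {β : ℝ} (hβ : β ∈ Set.Ioo 0 π) (hcos : cos β = ⟪v, w⟫_ℝ) :
    ∃ a, ∀ θ ∈ arcAngles a β, ∀ᶠ R : ℝ in atTop, R • circlePoint θ ∈ openSector p v w := by
  obtain ⟨a, rfl⟩ := exists_circlePoint_eq hv
  obtain ⟨b, rfl⟩ := exists_circlePoint_eq hw
  have hshift : ∀ (c : ℝ) (k : ℤ), circlePoint (2 * k * π + c) = circlePoint c := by
    intro c k
    rw [show 2 * (k : ℝ) * π + c = c + k * (2 * π) by ring]
    simp only [circlePoint, cos_add_int_mul_two_pi, sin_add_int_mul_two_pi]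
  rw [inner_circlePoint, cos_eq_cos_iff] at hcos
  obtain ⟨k, hk | hk⟩ := hcos
  · refine ⟨b, fun θ hθ => ?_⟩
    have ha : circlePoint a = circlePoint (b + β) := by
      rw [← hshift (b + β) k, show 2 * (k : ℝ) * π + (b + β) = a by linarith]
    rw [openSector_swap, ha]
    exact eventually_smul_circlePoint_mem_openSector p hβ hθ
  · refine ⟨a, fun θ hθ => ?_⟩
    have hb : circlePoint b = circlePoint (a + β) := by
      rw [← hshift b k, show 2 * (k : ℝ) * π + b = a + β by linarith]
    rw [hb]
    exact eventually_smul_circlePoint_mem_openSector p hβ hθ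

theorem sum_angle_le_two_pi {ι : Type*} [Fintype ι] (p v w : ι → EuclideanSpace ℝ (Fin 2))
    (hv : ∀ i, ‖v i‖ = 1) (hw : ∀ i, ‖w i‖ = 1) (β : ι → ℝ) (hβ : ∀ i, β i ∈ Set.Ioo 0 π)
    (hcos : ∀ i, cos (β i) = ⟪v i, w i⟫_ℝ)
    (hdisj : ∀ i j, i ≠ j →
      Disjoint (openSector (p i) (v i) (w i)) (openSector (p j) (v j) (w j))) :
    ∑ i, β i ≤ 2 * π := by
  choose a ha using fun i =>
    exists_arcAngles (p := p i) (hv i) (hw i) (hβ i) (hcos i)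
  have harc : ∀ i j θ, θ ∈ arcAngles (a i) (β i) → θ ∈ arcAngles (a j) (β j) → i = j := by
    intro i j θ hi hj
    by_contra hij
    obtain ⟨R, hRi, hRj⟩ := ((ha i θ hi).and (ha j θ hj)).exists
    exact Set.disjoint_left.1 (hdisj i j hij) hRi hRj
  have hle : ∀ θ, ∑ i, (arcAngles (a i) (β i)).indicator (fun _ => (1 : ℝ)) θ ≤ 1 := by
    intro θ
    by_cases h : ∃ i, θ ∈ arcAngles (a i) (β i)
    · obtain ⟨i, hi⟩ := h
      rw [Finset.sum_eq_single i
        (fun j _ hji => Set.indicator_of_notMem (fun hj => hji (harc j i θ hj hi)) _)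
        (fun hi => absurd (Finset.mem_univ i) hi), Set.indicator_of_mem hi]
    · push Not at h
      rw [Finset.sum_eq_zero fun i _ => Set.indicator_of_notMem (h i) _]
      exact zero_le_one
  calc ∑ i, β i
      ≤ ∑ i, ∫ θ in 0..2 * π, (arcAngles (a i) (β i)).indicator (fun _ => (1 : ℝ)) θ :=
        Finset.sum_le_sum fun i _ => le_integral_indicator_arcAngles (hβ i)
    _ = ∫ θ in 0..2 * π, ∑ i, (arcAngles (a i) (β i)).indicator (fun _ => (1 : ℝ)) θ :=
        (intervalIntegral.integral_finsetSum fun i _ =>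
          intervalIntegrable_indicator_arcAngles _ _ _ _).symm
    _ ≤ ∫ _ in 0..2 * π, (1 : ℝ) := by
        refine intervalIntegral.integral_mono_on two_pi_pos.le ?_ (by simp) fun θ _ => hle θ
        have := IntervalIntegrable.sum Finset.univ fun i _ =>
          intervalIntegrable_indicator_arcAngles (a i) (β i) 0 (2 * π)
        simpa only [Finset.sum_fn] using this
    _ = 2 * π := by simp

/-- Pairwise disjoint open sectors in the plane have total opening at most `2π`; in
particular, for `0 < ε < π/6` there are no three pairwise disjoint open sectors each of
opening `π − 2ε`. -/
theorem disjoint_sectors_total_angle (m : ℕ) (hm : 1 ≤ m)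
    (p v w : Fin m → EuclideanSpace ℝ (Fin 2))
    (hv : ∀ i, ‖v i‖ = 1) (hw : ∀ i, ‖w i‖ = 1)
    (hind : ∀ i, LinearIndependent ℝ ![v i, w i])
    (β : Fin m → ℝ) (hβ : ∀ i, β i ∈ Set.Ioo 0 π)
    (hcos : ∀ i, Real.cos (β i) = ⟪v i, w i⟫_ℝ)
    (hdisj : ∀ i j, i ≠ j →
      Disjoint
        {x : EuclideanSpace ℝ (Fin 2) | ∃ s t : ℝ, 0 < s ∧ 0 < t ∧ x = p i + s • v i + t • w i}
        {x : EuclideanSpace ℝ (Fin 2) | ∃ s t : ℝ, 0 < s ∧ 0 < t ∧ x = p j + s • v j + t • w j}) :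
    (∑ i, β i) ≤ 2 * π
      ∧ ∀ ε : ℝ, 0 < ε → ε < π / 6 →
          ¬ ∃ (q a b : Fin 3 → EuclideanSpace ℝ (Fin 2)),
              (∀ i, ‖a i‖ = 1) ∧ (∀ i, ‖b i‖ = 1)
                ∧ (∀ i, Real.cos (π - 2 * ε) = ⟪a i, b i⟫_ℝ)
                ∧ ∀ i j, i ≠ j →
                    Disjoint
                      {x : EuclideanSpace ℝ (Fin 2) |
                        ∃ s t : ℝ, 0 < s ∧ 0 < t ∧ x = q i + s • a i + t • b i}
                      {x : EuclideanSpace ℝ (Fin 2) |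
                        ∃ s t : ℝ, 0 < s ∧ 0 < t ∧ x = q j + s • a j + t • b j} := by
  refine ⟨sum_angle_le_two_pi p v w hv hw β hβ hcos hdisj, ?_⟩
  rintro ε hε hε' ⟨q, a, b, ha, hb, hab, hdisj'⟩
  have h := sum_angle_le_two_pi q a b ha hb (fun _ => π - 2 * ε)
    (fun _ => ⟨by linarith, by linarith⟩) hab hdisj'
  simp only [Fin.sum_univ_three] at h
  linarith
end
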